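/- Let X be an Asplund space, (Ω,Σ,μ) a complete finite measure space, and Γ: Ω ⇉ X* a w*-scalarly integrable multifunction with nonempty w*-compact values that admits at least one Gelfand-integrable selector. Then for every x ∈ X one has ∫ s(x,Γ(ω)) dμ = sup_{f ∈ S¹_Γ} ∫ ⟨f(ω),x⟩ dμ. -/

import Mathlib

open MeasureTheory Filter Topology Metric Set Pointwise
open scoped NNReal ENNReal

noncomputable section

universe u v

namespace Paper

section Defs

variable {X : Type u} [NormedAddCommGroup X] [NormedSpace ℝ X]
variable {Ω : Type v} [MeasurableSpace Ω]

/-- The identity map from the (strong) dual to the dual endowed with the weak* topology. -/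
def wstar : (X →L[ℝ] ℝ) → WeakDual ℝ X := fun φ => φ

/-- Support function `s(x,C)` of a set `C ⊆ X*`. -/
def supp (x : X) (C : Set (X →L[ℝ] ℝ)) : ℝ :=
  sSup ((fun φ : X →L[ℝ] ℝ => φ x) '' C)

/-- `f` is Gelfand integrable: all scalarizations are integrable and the scalar
integrals are represented by a continuous linear functional. -/
def GelfandIntegrable (μ : Measure Ω) (f : Ω → X →L[ℝ] ℝ) : Prop :=
  (∀ x : X, Integrable (fun ω => f ω x) μ) ∧
    ∃ g : X →L[ℝ] ℝ, ∀ x : X, g x = ∫ ω, f ω x ∂μ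

/-- The set `S¹_Γ` of Gelfand-integrable a.e. selectors of `Γ`. -/
def selectors (μ : Measure Ω) (Γ : Ω → Set (X →L[ℝ] ℝ)) : Set (Ω → X →L[ℝ] ℝ) :=
  { f | GelfandIntegrable μ f ∧ ∀ᵐ ω ∂μ, f ω ∈ Γ ω }

/-- The Gelfand integral `I(Γ) = { ∫ f dμ : f ∈ S¹_Γ }` of a multifunction. -/
def gelfandIntegral (μ : Measure Ω) (Γ : Ω → Set (X →L[ℝ] ℝ)) : Set (X →L[ℝ] ℝ) :=
  { g | ∃ f ∈ selectors μ Γ, ∀ x : X, g x = ∫ ω, f ω x ∂μ }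

/-- The set `S^{1,w*}_Γ` of Gelfand-integrable w*-almost selectors of `Γ`. -/
def almostSelectors (μ : Measure Ω) (Γ : Ω → Set (X →L[ℝ] ℝ)) : Set (Ω → X →L[ℝ] ℝ) :=
  { f | GelfandIntegrable μ f ∧ ∀ x : X, ∀ᵐ ω ∂μ, f ω x ≤ supp x (Γ ω) }

/-- `Γ` is w*-scalarly measurable. -/
def WScalarlyMeasurable (Γ : Ω → Set (X →L[ℝ] ℝ)) : Prop :=
  ∀ x : X, Measurable fun ω => supp x (Γ ω)

/-- `Γ` is w*-scalarly integrable. -/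
def WScalarlyIntegrable (μ : Measure Ω) (Γ : Ω → Set (X →L[ℝ] ℝ)) : Prop :=
  ∀ x : X, Integrable (fun ω => supp x (Γ ω)) μ

/-- `Γ` is integrably bounded. -/
def IntegrablyBounded (μ : Measure Ω) (Γ : Ω → Set (X →L[ℝ] ℝ)) : Prop :=
  ∃ ψ : Ω → ℝ, Integrable ψ μ ∧ ∀ ω : Ω, ∀ φ ∈ Γ ω, ‖φ‖ ≤ ψ ω

/-- `C ⊆ X*` is weak*-closed. -/
def WStarClosed (C : Set (X →L[ℝ] ℝ)) : Prop := IsClosed (wstar '' C)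

/-- `C ⊆ X*` is weak*-compact. -/
def WStarCompact (C : Set (X →L[ℝ] ℝ)) : Prop := IsCompact (wstar '' C)

/-- Weak*-closure of `C ⊆ X*`. -/
def wstarClosure (C : Set (X →L[ℝ] ℝ)) : Set (X →L[ℝ] ℝ) :=
  wstar ⁻¹' closure (wstar '' C)

/-- Weak*-closed convex hull of `C ⊆ X*`. -/
def wstarClosedConvexHull (C : Set (X →L[ℝ] ℝ)) : Set (X →L[ℝ] ℝ) :=
  wstar ⁻¹' closure (convexHull ℝ (wstar '' C))

/-- `Y` is an Asplund space: every continuous convex real function on an open convex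
set is Fréchet differentiable on a dense subset of that set. -/
def Asplund (Y : Type*) [NormedAddCommGroup Y] [NormedSpace ℝ Y] : Prop :=
  ∀ U : Set Y, IsOpen U → Convex ℝ U →
    ∀ f : Y → ℝ, ContinuousOn f U → ConvexOn ℝ U f →
      U ⊆ closure { y | y ∈ U ∧ ∃ f' : Y →L[ℝ] ℝ, HasFDerivWithinAt f f' U y }

/-- `μ` is a nonatomic measure. -/
def Nonatomic (μ : Measure Ω) : Prop :=
  ∀ A : Set Ω, MeasurableSet A → 0 < μ A →
    ∃ B : Set Ω, MeasurableSet B ∧ B ⊆ A ∧ 0 < μ B ∧ μ B < μ A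

/-- `μ` is a saturated measure: `L¹` of every positive-measure restriction is nonseparable. -/
def Saturated (μ : Measure Ω) : Prop :=
  ∀ E : Set Ω, MeasurableSet E → 0 < μ E →
    ¬ TopologicalSpace.SeparableSpace (Lp ℝ 1 (μ.restrict E))

/-- `dens(Y)`: smallest cardinality of a dense subset of the open unit ball of `Y`. -/
def densCard (Y : Type u) [NormedAddCommGroup Y] : Cardinal.{u} :=
  sInf { c : Cardinal.{u} |
    ∃ D : Set Y, D ⊆ ball (0 : Y) 1 ∧ ball (0 : Y) 1 ⊆ closure D ∧ Cardinal.mk ↥D = c }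

/-- `dens(Y) < κ(μ)`: every family of `μ`-null measurable sets of cardinality at most
`dens(Y)` has measurable union. -/
def DensLtAdditivity (Y : Type u) [NormedAddCommGroup Y] (μ : Measure Ω) : Prop :=
  ∀ 𝒞 : Set (Set Ω), (∀ A ∈ 𝒞, MeasurableSet A ∧ μ A = 0) →
    Cardinal.lift.{u} (Cardinal.mk ↥𝒞) ≤ Cardinal.lift.{v} (densCard Y) →
    MeasurableSet (⋃₀ 𝒞)

/-- Clarke generalized directional derivative `ψ°(x̄;h)`. -/
def clarkeDD (ψ : X → ℝ) (xbar h : X) : ℝ :=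
  limsup (fun p : X × ℝ => (ψ (p.1 + p.2 • h) - ψ p.1) / p.2) ((𝓝 xbar) ×ˢ (𝓝[>] (0 : ℝ)))

/-- Clarke generalized gradient `∂°ψ(x̄)`. -/
def clarkeSubdiff (ψ : X → ℝ) (xbar : X) : Set (X →L[ℝ] ℝ) :=
  { φ | ∀ h : X, φ h ≤ clarkeDD ψ xbar h }

/-- `ψ` is (Clarke) regular at `x̄`: the directional derivative exists and equals `ψ°`. -/
def ClarkeRegularAt (ψ : X → ℝ) (xbar : X) : Prop :=
  ∀ h : X, Tendsto (fun θ : ℝ => (ψ (xbar + θ • h) - ψ xbar) / θ) (𝓝[>] (0 : ℝ))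
    (𝓝 (clarkeDD ψ xbar h))

/-- Limiting (Mordukhovich) subdifferential `∂ψ(x̄)`. -/
def limitingSubdiff (ψ : X → ℝ) (xbar : X) : Set (X →L[ℝ] ℝ) :=
  { p | ∃ (xk : ℕ → X) (pk : ℕ → X →L[ℝ] ℝ),
      Tendsto xk atTop (𝓝 xbar) ∧
      (∀ z : X, Tendsto (fun k => pk k z) atTop (𝓝 (p z))) ∧
      ∀ k : ℕ, 0 ≤ liminf
        (fun y => (ψ y - ψ (xk k) - pk k (y - xk k)) / ‖y - xk k‖) (𝓝[≠] (xk k)) }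

/-- Clarke generalized normal cone `N°(z̄;C)`. -/
def clarkeNormalCone (C : Set X) (zbar : X) : Set (X →L[ℝ] ℝ) :=
  wstarClosure (⋃ α ∈ Ioi (0 : ℝ), α • clarkeSubdiff (fun z => infDist z C) zbar)

/-- Limiting normal cone `N(z̄;C)`. -/
def limitingNormalCone (C : Set X) (zbar : X) : Set (X →L[ℝ] ℝ) :=
  ⋃ α ∈ Ioi (0 : ℝ), α • limitingSubdiff (fun z => infDist z C) zbar

/-- A multifunction is lower semicontinuous. -/
def LowerSC {Y : Type*} [TopologicalSpace Y] {Z : Type*} [TopologicalSpace Z]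
    (F : Y → Set Z) : Prop :=
  ∀ U : Set Z, IsOpen U → IsOpen { y | (F y ∩ U).Nonempty }

/-- A multifunction is upper semicontinuous. -/
def UpperSC {Y : Type*} [TopologicalSpace Y] {Z : Type*} [TopologicalSpace Z]
    (F : Y → Set Z) : Prop :=
  ∀ U : Set Z, IsOpen U → IsOpen { y | F y ⊆ U }

/-- `P` is a stochastic kernel (transition probability). -/
def StochasticKernel (P : Ω → Measure Ω) : Prop :=
  (∀ ω, IsProbabilityMeasure (P ω)) ∧
    ∀ A : Set Ω, MeasurableSet A → Measurable fun ω => P ω A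

/-- `v` is a bounded Carathéodory solution of the Bellman equation, the minimum
over `Γ x ω` being attained. -/
def BellmanSolution (P : Ω → Measure Ω) (β : ℝ) (u : X → X → Ω → ℝ)
    (Γ : X → Ω → Set X) (v : X → Ω → ℝ) : Prop :=
  (∃ M : ℝ, ∀ x ω, |v x ω| ≤ M) ∧
  (∀ ω, Continuous fun x => v x ω) ∧
  (∀ x, Measurable fun ω => v x ω) ∧
  ∀ x ω,
    (∃ y ∈ Γ x ω, v x ω = u x y ω + β * ∫ ω', v y ω' ∂(P ω)) ∧
    ∀ y ∈ Γ x ω, v x ω ≤ u x y ω + β * ∫ ω', v y ω' ∂(P ω)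

/-- The policy multifunction `G(x,ω)` associated with a Bellman solution `v`. -/
def policyMap (P : Ω → Measure Ω) (β : ℝ) (u : X → X → Ω → ℝ)
    (Γ : X → Ω → Set X) (v : X → Ω → ℝ) (x : X) (ω : Ω) : Set X :=
  { y ∈ Γ x ω | v x ω = u x y ω + β * ∫ ω', v y ω' ∂(P ω) }

/-- Standing assumptions (H1), (H2) on the stochastic DP problem. -/
def DPStandingAssumptions [MeasurableSpace X] (P : Ω → Measure Ω) (β : ℝ)
    (u : X → X → Ω → ℝ) (Γ : X → Ω → Set X) : Prop :=
  StochasticKernel P ∧ 0 ≤ β ∧ β < 1 ∧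
  (∃ M : ℝ, ∀ x y ω, |u x y ω| ≤ M) ∧
  (∀ ω, Continuous fun p : X × X => u p.1 p.2 ω) ∧
  (∀ x y, Measurable fun ω => u x y ω) ∧
  (∀ x ω, (Γ x ω).Nonempty ∧ IsCompact (Γ x ω)) ∧
  (∀ U : Set X, IsOpen U → MeasurableSet { p : X × Ω | (Γ p.1 p.2 ∩ U).Nonempty }) ∧
  (∀ ω, LowerSC (fun x => Γ x ω) ∧ UpperSC (fun x => Γ x ω)) ∧
  (∀ x, ∀ U : Set X, IsOpen U → MeasurableSet { ω | (Γ x ω ∩ U).Nonempty })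

/-- `G` is locally lower viable around `x̄` (relative to `Γ`). -/
def LocLowerViable (G Γ : X → Ω → Set X) (xbar : X) : Prop :=
  ∀ ω, ∃ U ∈ 𝓝 xbar, ∀ x ∈ U, ∀ x' ∈ U, (G x ω ∩ Γ x' ω).Nonempty

/-- `G` is locally upper viable around `x̄` (relative to `Γ`). -/
def LocUpperViable (G Γ : X → Ω → Set X) (xbar : X) : Prop :=
  ∀ ω, ∃ U ∈ 𝓝 xbar, ∀ x ∈ U, ∀ x' ∈ U, G x ω ⊆ Γ x' ω

end Defs

section SupportFunction

variable {X : Type u} [NormedAddCommGroup X] [NormedSpace ℝ X] {C : Set (X →L[ℝ] ℝ)}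

theorem WStarCompact.isCompact_image_apply (hC : WStarCompact C) (x : X) :
    IsCompact ((fun φ : X →L[ℝ] ℝ => φ x) '' C) := by
  have h := IsCompact.image hC (WeakDual.eval_continuous (𝕜 := ℝ) x)
  rw [Set.image_image] at h
  exact h

theorem WStarCompact.le_supp (hC : WStarCompact C) (x : X) {φ : X →L[ℝ] ℝ} (hφ : φ ∈ C) :
    φ x ≤ supp x C :=
  le_csSup (hC.isCompact_image_apply x).bddAbove (Set.mem_image_of_mem _ hφ)

theorem WStarCompact.exists_apply_eq_supp (hC : WStarCompact C) (hne : C.Nonempty) (x : X) :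
    ∃ φ ∈ C, φ x = supp x C :=
  (hC.isCompact_image_apply x).sSup_mem (hne.image _)

theorem WStarCompact.supp_add_le (hC : WStarCompact C) (hne : C.Nonempty) (x y : X) :
    supp (x + y) C ≤ supp x C + supp y C := by
  obtain ⟨φ, hφ, h⟩ := hC.exists_apply_eq_supp hne (x + y)
  rw [← h, map_add]
  exact add_le_add (hC.le_supp x hφ) (hC.le_supp y hφ)

theorem WStarCompact.supp_smul (hC : WStarCompact C) (hne : C.Nonempty) {a : ℝ} (ha : 0 ≤ a)
    (x : X) : supp (a • x) C = a * supp x C := by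
  apply le_antisymm
  · obtain ⟨φ, hφ, h⟩ := hC.exists_apply_eq_supp hne (a • x)
    rw [← h, map_smul, smul_eq_mul]
    exact mul_le_mul_of_nonneg_left (hC.le_supp x hφ) ha
  · obtain ⟨φ, hφ, h⟩ := hC.exists_apply_eq_supp hne x
    rw [← h, ← smul_eq_mul, ← map_smul]
    exact hC.le_supp _ hφ

theorem supp_zero (hne : C.Nonempty) : supp (0 : X) C = 0 := by
  simp [supp, hne.image_const]

/-- The support function of a weak*-compact set is attained, hence sequentially lower
semicontinuous; this is the symmetrized form, with values in `ℝ≥0∞`. -/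
theorem WStarCompact.ofReal_width_le_liminf (hC : WStarCompact C) (hne : C.Nonempty)
    {u : ℕ → X} {x : X} (hu : Tendsto u atTop (𝓝 x)) :
    ENNReal.ofReal (supp x C + supp (-x) C) ≤
      liminf (fun n => ENNReal.ofReal (supp (u n) C + supp (-u n) C)) atTop := by
  obtain ⟨φ, hφ, h⟩ := hC.exists_apply_eq_supp hne x
  obtain ⟨ψ, hψ, h'⟩ := hC.exists_apply_eq_supp hne (-x)
  have hlim : Tendsto (fun n => ENNReal.ofReal (φ (u n) + ψ (-u n))) atTop
      (𝓝 (ENNReal.ofReal (φ x + ψ (-x)))) :=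
    ENNReal.tendsto_ofReal
      (((φ.continuous.tendsto x).comp hu).add ((ψ.continuous.tendsto (-x)).comp hu.neg))
  rw [← h, ← h', ← hlim.liminf_eq]
  exact liminf_le_liminf (Eventually.of_forall fun n =>
    ENNReal.ofReal_le_ofReal (add_le_add (hC.le_supp _ hφ) (hC.le_supp _ hψ)))

end SupportFunction

/-- A function squeezed between integrable functions whose integrals converge to a common limit
is integrable, with that limit as integral. -/
theorem integrable_and_integral_eq_of_squeeze {Ω : Type v} [MeasurableSpace Ω] {μ : Measure Ω}
    {p q : ℕ → Ω → ℝ} {h : Ω → ℝ} {c : ℝ}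
    (hp : ∀ n, Integrable (p n) μ) (hq : ∀ n, Integrable (q n) μ)
    (hph : ∀ n ω, p n ω ≤ h ω) (hhq : ∀ n ω, h ω ≤ q n ω)
    (hpc : Tendsto (fun n => ∫ ω, p n ω ∂μ) atTop (𝓝 c))
    (hqc : Tendsto (fun n => ∫ ω, q n ω ∂μ) atTop (𝓝 c)) :
    Integrable h μ ∧ ∫ ω, h ω ∂μ = c := by
  have hdiff : Tendsto (fun n => ∫ ω, (q n ω - p n ω) ∂μ) atTop (𝓝 0) := by
    simpa [integral_sub (hq _) (hp _)] using hqc.sub hpc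
  have hmeas : TendstoInMeasure μ (fun n => q n - p n) atTop 0 := by
    refine tendstoInMeasure_of_tendsto_eLpNorm one_ne_zero
      (fun n => ((hq n).sub (hp n)).aestronglyMeasurable) aestronglyMeasurable_zero ?_
    have heq : ∀ n, eLpNorm (q n - p n - 0) 1 μ = ENNReal.ofReal (∫ ω, (q n ω - p n ω) ∂μ) := by
      intro n
      have hnonneg : ∀ ω, 0 ≤ q n ω - p n ω := fun ω =>
        sub_nonneg.2 ((hph n ω).trans (hhq n ω))
      rw [sub_zero, eLpNorm_one_eq_lintegral_enorm,
        ofReal_integral_eq_lintegral_ofReal (f := fun ω => q n ω - p n ω) ((hq n).sub (hp n))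
          (Eventually.of_forall hnonneg)]
      exact lintegral_congr fun ω => Real.enorm_of_nonneg (hnonneg ω)
    simpa only [heq, ENNReal.ofReal_zero] using ENNReal.tendsto_ofReal hdiff
  obtain ⟨ns, -, hns⟩ := hmeas.exists_seq_tendsto_ae
  have hsm : AEStronglyMeasurable h μ := by
    refine aestronglyMeasurable_of_tendsto_ae atTop
      (fun k => (hq (ns k)).aestronglyMeasurable) ?_
    filter_upwards [hns] with ω hω
    have hlow : Tendsto (fun k => h ω + (q (ns k) - p (ns k)) ω) atTop (𝓝 (h ω)) := by
      simpa using hω.const_add (h ω)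
    refine tendsto_of_tendsto_of_tendsto_of_le_of_le tendsto_const_nhds hlow
      (fun k => hhq _ ω) (fun k => ?_)
    have := hph (ns k) ω
    simp only [Pi.sub_apply]
    linarith
  have hint : Integrable h μ :=
    integrable_of_le_of_le hsm (Eventually.of_forall (hph 0)) (Eventually.of_forall (hhq 0))
      (hp 0) (hq 0)
  exact ⟨hint, le_antisymm
    (ge_of_tendsto' hqc fun n => integral_mono hint (hq n) (hhq n))
    (le_of_tendsto' hpc fun n => integral_mono (hp n) hint (hph n))⟩

section IntegralSupport

variable {X : Type u} [NormedAddCommGroup X] [NormedSpace ℝ X]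
variable {Ω : Type v} [MeasurableSpace Ω] {μ : Measure Ω} {Γ : Ω → Set (X →L[ℝ] ℝ)}

theorem integral_supp_add_le (hne : ∀ ω, (Γ ω).Nonempty) (hcpt : ∀ ω, WStarCompact (Γ ω))
    (hsi : WScalarlyIntegrable μ Γ) (x y : X) :
    ∫ ω, supp (x + y) (Γ ω) ∂μ ≤ ∫ ω, supp x (Γ ω) ∂μ + ∫ ω, supp y (Γ ω) ∂μ := by
  rw [← integral_add (hsi x) (hsi y)]
  exact integral_mono (hsi _) ((hsi x).add (hsi y)) fun ω => (hcpt ω).supp_add_le (hne ω) x y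

theorem integral_supp_smul (hne : ∀ ω, (Γ ω).Nonempty) (hcpt : ∀ ω, WStarCompact (Γ ω))
    {a : ℝ} (ha : 0 ≤ a) (x : X) :
    ∫ ω, supp (a • x) (Γ ω) ∂μ = a * ∫ ω, supp x (Γ ω) ∂μ := by
  rw [← integral_const_mul]
  exact integral_congr_ae (Eventually.of_forall fun ω => (hcpt ω).supp_smul (hne ω) ha x)

theorem integral_supp_zero (hne : ∀ ω, (Γ ω).Nonempty) :
    ∫ ω, supp (0 : X) (Γ ω) ∂μ = 0 := by
  simp [supp_zero (hne _)]

theorem convexOn_integral_supp (hne : ∀ ω, (Γ ω).Nonempty) (hcpt : ∀ ω, WStarCompact (Γ ω))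
    (hsi : WScalarlyIntegrable μ Γ) :
    ConvexOn ℝ Set.univ fun x : X => ∫ ω, supp x (Γ ω) ∂μ := by
  refine ⟨convex_univ, fun x _ y _ a b ha hb _ => ?_⟩
  simp only [smul_eq_mul]
  rw [← integral_supp_smul hne hcpt ha, ← integral_supp_smul hne hcpt hb]
  exact integral_supp_add_le hne hcpt hsi _ _

/-- The seminorm `x ↦ ∫ (s(x,Γ) + s(-x,Γ)) dμ`. -/
def widthSeminorm (μ : Measure Ω) (Γ : Ω → Set (X →L[ℝ] ℝ)) (hne : ∀ ω, (Γ ω).Nonempty)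
    (hcpt : ∀ ω, WStarCompact (Γ ω)) (hsi : WScalarlyIntegrable μ Γ) : Seminorm ℝ X :=
  Seminorm.of (fun x => ∫ ω, supp x (Γ ω) ∂μ + ∫ ω, supp (-x) (Γ ω) ∂μ)
    (fun x y => by
      have h₁ := integral_supp_add_le hne hcpt hsi x y
      have h₂ := integral_supp_add_le hne hcpt hsi (-x) (-y)
      rw [neg_add]
      linarith)
    (fun a x => by
      rcases le_total 0 a with ha | ha
      · rw [← smul_neg, integral_supp_smul hne hcpt ha, integral_supp_smul hne hcpt ha,
          Real.norm_of_nonneg ha, mul_add]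
      · have ha' : 0 ≤ -a := neg_nonneg.2 ha
        rw [← neg_smul, ← neg_smul_neg a x, integral_supp_smul hne hcpt ha',
          integral_supp_smul hne hcpt ha', Real.norm_of_nonpos ha, mul_add, add_comm])

theorem lowerSemicontinuous_widthSeminorm (hne : ∀ ω, (Γ ω).Nonempty)
    (hcpt : ∀ ω, WStarCompact (Γ ω)) (hsi : WScalarlyIntegrable μ Γ) :
    LowerSemicontinuous (widthSeminorm μ Γ hne hcpt hsi) := by
  have hint : ∀ x : X, Integrable (fun ω => supp x (Γ ω) + supp (-x) (Γ ω)) μ := fun x =>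
    (hsi x).add (hsi (-x))
  have hnonneg : ∀ (x : X) (ω : Ω), 0 ≤ supp x (Γ ω) + supp (-x) (Γ ω) := fun x ω => by
    simpa [supp_zero (hne ω)] using (hcpt ω).supp_add_le (hne ω) x (-x)
  have hlint : ∀ x : X, ENNReal.ofReal (widthSeminorm μ Γ hne hcpt hsi x) =
      ∫⁻ ω, ENNReal.ofReal (supp x (Γ ω) + supp (-x) (Γ ω)) ∂μ := fun x => by
    rw [← ofReal_integral_eq_lintegral_ofReal (hint x) (Eventually.of_forall (hnonneg x)),
      integral_add (hsi x) (hsi (-x))]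
    rfl
  rw [lowerSemicontinuous_iff_isClosed_preimage]
  intro a
  refine IsSeqClosed.isClosed fun u x hu hux => ?_
  have ha : 0 ≤ a := (apply_nonneg _ (u 0)).trans (hu 0)
  rw [Set.mem_preimage, Set.mem_Iic, ← ENNReal.ofReal_le_ofReal_iff ha, hlint]
  calc ∫⁻ ω, ENNReal.ofReal (supp x (Γ ω) + supp (-x) (Γ ω)) ∂μ
      ≤ ∫⁻ ω, liminf (fun n => ENNReal.ofReal (supp (u n) (Γ ω) + supp (-u n) (Γ ω))) atTop ∂μ :=
        lintegral_mono fun ω => (hcpt ω).ofReal_width_le_liminf (hne ω) hux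
    _ ≤ liminf (fun n => ∫⁻ ω, ENNReal.ofReal (supp (u n) (Γ ω) + supp (-u n) (Γ ω)) ∂μ) atTop :=
        lintegral_liminf_le' fun n => (hint (u n)).aestronglyMeasurable.aemeasurable.ennreal_ofReal
    _ ≤ ENNReal.ofReal a := by
        refine liminf_le_of_frequently_le' (Frequently.of_forall fun n => ?_)
        rw [← hlint]
        exact ENNReal.ofReal_le_ofReal (hu n)

/-- The integral of the support function dominates the integral of any selector. -/
theorem integral_le_integral_supp (hcpt : ∀ ω, WStarCompact (Γ ω))
    (hsi : WScalarlyIntegrable μ Γ) {f : Ω → X →L[ℝ] ℝ} (hf : f ∈ selectors μ Γ) (x : X) :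
    ∫ ω, f ω x ∂μ ≤ ∫ ω, supp x (Γ ω) ∂μ :=
  integral_mono_ae (hf.1.1 x) (hsi x) (hf.2.mono fun ω hω => (hcpt ω).le_supp x hω)

theorem continuous_integral_supp [CompleteSpace X] (hne : ∀ ω, (Γ ω).Nonempty)
    (hcpt : ∀ ω, WStarCompact (Γ ω)) (hsi : WScalarlyIntegrable μ Γ)
    (hsel : (selectors μ Γ).Nonempty) :
    Continuous fun x : X => ∫ ω, supp x (Γ ω) ∂μ := by
  obtain ⟨f, hf⟩ := hsel
  obtain ⟨g, hg⟩ := hf.1.2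
  set P := widthSeminorm μ Γ hne hcpt hsi
  have hPc : Continuous P :=
    P.continuous_of_lowerSemicontinuous (lowerSemicontinuous_widthSeminorm hne hcpt hsi)
  have hbound : ∀ z : X, ∫ ω, supp z (Γ ω) ∂μ ≤ P z + g z := fun z => by
    have h := integral_le_integral_supp hcpt hsi hf (-z)
    rw [← hg, map_neg] at h
    have hPz : P z = ∫ ω, supp z (Γ ω) ∂μ + ∫ ω, supp (-z) (Γ ω) ∂μ := rfl
    linarith
  rw [continuous_iff_continuousAt]
  intro x
  have hzero : Tendsto (fun y => P (y - x) + g (y - x)) (𝓝 x) (𝓝 0) := by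
    have : Continuous fun y => P (y - x) + g (y - x) := by fun_prop
    simpa using this.tendsto x
  have hzero' : Tendsto (fun y => P (x - y) + g (x - y)) (𝓝 x) (𝓝 0) := by
    have : Continuous fun y => P (x - y) + g (x - y) := by fun_prop
    simpa using this.tendsto x
  refine tendsto_of_tendsto_of_tendsto_of_le_of_le
    (by simpa using hzero'.const_sub (∫ ω, supp x (Γ ω) ∂μ))
    (by simpa using hzero.const_add (∫ ω, supp x (Γ ω) ∂μ)) (fun y => ?_) (fun y => ?_)
  · have h := integral_supp_add_le hne hcpt hsi y (x - y)
    rw [add_sub_cancel] at h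
    have := hbound (x - y)
    rw [map_sub g] at this
    linarith
  · have h := integral_supp_add_le hne hcpt hsi x (y - x)
    rw [add_sub_cancel] at h
    have := hbound (y - x)
    rw [map_sub g] at this
    linarith

/-- At a point of differentiability `y` of the integral of the support function, every selection
of the faces of `Γ` exposed by `y` is Gelfand integrable, and the derivative is its integral. -/
theorem integrable_and_integral_eq_of_hasFDerivAt (hcpt : ∀ ω, WStarCompact (Γ ω))
    (hsi : WScalarlyIntegrable μ Γ) {y : X} {f' : X →L[ℝ] ℝ}
    (hf' : HasFDerivAt (fun x : X => ∫ ω, supp x (Γ ω) ∂μ) f' y)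
    {g : Ω → X →L[ℝ] ℝ} (hgΓ : ∀ ω, g ω ∈ Γ ω) (hgy : ∀ ω, g ω y = supp y (Γ ω)) (z : X) :
    Integrable (fun ω => g ω z) μ ∧ ∫ ω, g ω z ∂μ = f' z := by
  set D : ℝ → Ω → ℝ := fun t ω => t⁻¹ * (supp (y + t • z) (Γ ω) - supp y (Γ ω)) with hD
  have hDint : ∀ t, Integrable (D t) μ := fun t => ((hsi _).sub (hsi y)).const_mul _
  have hDlim : Tendsto (fun t => ∫ ω, D t ω ∂μ) (𝓝[≠] 0) (𝓝 (f' z)) := by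
    have h := hasDerivAt_iff_tendsto_slope_zero.1 (hf'.hasLineDerivAt z)
    refine h.congr fun t => ?_
    simp only [hD, zero_add, zero_smul, add_zero, smul_eq_mul]
    rw [integral_const_mul, integral_sub (hsi _) (hsi y)]
  have hincr : ∀ (t : ℝ) (ω : Ω), t * g ω z ≤ supp (y + t • z) (Γ ω) - supp y (Γ ω) := by
    intro t ω
    have h := (hcpt ω).le_supp (y + t • z) (hgΓ ω)
    rw [map_add, map_smul, smul_eq_mul, hgy] at h
    linarith
  have ht : Tendsto (fun n : ℕ => 1 / ((n : ℝ) + 1)) atTop (𝓝 0) :=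
    tendsto_one_div_add_atTop_nhds_zero_nat
  have htpos : ∀ n : ℕ, 0 < 1 / ((n : ℝ) + 1) := fun n => Nat.one_div_pos_of_nat
  have hlim : Tendsto (fun n : ℕ => 1 / ((n : ℝ) + 1)) atTop (𝓝[≠] 0) :=
    tendsto_nhdsWithin_iff.2 ⟨ht, Eventually.of_forall fun n => (htpos n).ne'⟩
  have hlim' : Tendsto (fun n : ℕ => -(1 / ((n : ℝ) + 1))) atTop (𝓝[≠] 0) :=
    tendsto_nhdsWithin_iff.2
      ⟨by simpa using ht.neg, Eventually.of_forall fun n => (neg_neg_of_pos (htpos n)).ne⟩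
  refine integrable_and_integral_eq_of_squeeze (fun n => hDint (-(1 / ((n : ℝ) + 1))))
    (fun n => hDint (1 / ((n : ℝ) + 1))) (fun n ω => ?_) (fun n ω => ?_)
    (hDlim.comp hlim') (hDlim.comp hlim)
  · have h := (le_inv_mul_iff₀ (htpos n)).2 ((neg_mul_comm _ _).symm.trans_le (hincr _ ω))
    simp only [hD, inv_neg, neg_mul]
    exact neg_le.1 h
  · exact (le_inv_mul_iff₀ (htpos n)).2 (hincr _ ω)

end IntegralSupport

/-- supremum representation of the integral of the support function of a
w*-scalarly integrable multifunction with nonempty w*-compact values. -/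
theorem gelfand_supremum_representation
    {X : Type u} [NormedAddCommGroup X] [NormedSpace ℝ X] [CompleteSpace X]
    (hX : Asplund X)
    {Ω : Type v} [MeasurableSpace Ω] (μ : Measure Ω)
    (hcomp : μ.IsComplete) [IsFiniteMeasure μ]
    (Γ : Ω → Set (X →L[ℝ] ℝ))
    (hne : ∀ ω, (Γ ω).Nonempty)
    (hcpt : ∀ ω, WStarCompact (Γ ω))
    (hsi : WScalarlyIntegrable μ Γ)
    (hsel : (selectors μ Γ).Nonempty) :
    ∀ x : X,
      ∫ ω, supp x (Γ ω) ∂μ =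
        sSup ((fun f : Ω → X →L[ℝ] ℝ => ∫ ω, f ω x ∂μ) '' selectors μ Γ) := by
  intro x
  set Φ : X → ℝ := fun x => ∫ ω, supp x (Γ ω) ∂μ
  have hcont : Continuous Φ := continuous_integral_supp hne hcpt hsi hsel
  have hbdd : ∀ a ∈ (fun f : Ω → X →L[ℝ] ℝ => ∫ ω, f ω x ∂μ) '' selectors μ Γ, a ≤ Φ x := by
    rintro _ ⟨f, hf, rfl⟩
    exact integral_le_integral_supp hcpt hsi hf x
  refine (csSup_eq_of_forall_le_of_forall_lt_exists_gt (hsel.image _) hbdd fun w hw => ?_).symm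
  have hnear : ∀ᶠ y in 𝓝 x, w < Φ y - Φ (y - x) := by
    have hc : Continuous fun y => Φ y - Φ (y - x) := by fun_prop
    refine hc.continuousAt.eventually (lt_mem_nhds ?_)
    have h0 : Φ 0 = 0 := integral_supp_zero hne
    simpa [h0] using hw
  have hdense := hX Set.univ isOpen_univ convex_univ Φ hcont.continuousOn
    (convexOn_integral_supp hne hcpt hsi) (Set.mem_univ x)
  obtain ⟨y, hwy, -, f', hf'⟩ := mem_closure_iff_nhds.1 hdense _ hnear
  rw [hasFDerivWithinAt_univ] at hf'
  choose g hgΓ hgy using fun ω => (hcpt ω).exists_apply_eq_supp (hne ω) y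
  have hg := integrable_and_integral_eq_of_hasFDerivAt hcpt hsi hf' hgΓ hgy
  have hgsel : g ∈ selectors μ Γ :=
    ⟨⟨fun z => (hg z).1, f', fun z => (hg z).2.symm⟩, Eventually.of_forall hgΓ⟩
  refine ⟨_, Set.mem_image_of_mem _ hgsel, hwy.trans_le ?_⟩
  have hy : f' y = Φ y := by
    rw [← (hg y).2]
    exact integral_congr_ae (Eventually.of_forall hgy)
  have hyx : f' (y - x) ≤ Φ (y - x) := by
    rw [← (hg (y - x)).2]
    exact integral_le_integral_supp hcpt hsi hgsel (y - x)
  rw [map_sub, hy] at hyx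
  simp only [(hg x).2]
  linarith

end Paper
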